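/- Strict monotonicity of the potential in the channel: if c1, c2 ∈ X satisfy c1 ≻ c2 (c1 strictly degraded with respect to c2) and x ∈ X with x ≠ Δ_∞ (the unit point mass at +∞), then U(x; c1) < U(x; c2). -/

import Mathlib

open MeasureTheory Real Filter Topology Polynomial

noncomputable section

/-- The space of finite signed Borel measures on the extended reals `ℝ̄`. -/
abbrev SM := MeasureTheory.SignedMeasure EReal

namespace SCLDPC

/-- The weight `e^{-α/2}` as an extended nonnegative real (`+∞` at `α = -∞`). -/
def wt (α : EReal) : ENNReal :=
  if α = ⊥ then ⊤ else if α = ⊤ then 0 else ENNReal.ofReal (Real.exp (-(α.toReal) / 2))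

/-- A (nonnegative) Borel measure `μ` on `ℝ̄` is symmetric if
`∫_{-E} e^{-α/2} μ(dα) = ∫_{E} e^{-α/2} μ(dα)` for every Borel set `E`
(stated with extended nonnegative integrals, which is equivalent to requiring
equality whenever one of the two sides is finite). -/
def IsSymmMeasure (μ : Measure EReal) : Prop :=
  ∀ E : Set EReal, MeasurableSet E →
    ∫⁻ α in (fun a : EReal => -a) ⁻¹' E, wt α ∂μ = ∫⁻ α in E, wt α ∂μ

/-- Positive part of the Jordan decomposition. -/
def jp (x : SM) : Measure EReal := x.toJordanDecomposition.posPart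

/-- Negative part of the Jordan decomposition. -/
def jn (x : SM) : Measure EReal := x.toJordanDecomposition.negPart

instance (x : SM) : IsFiniteMeasure (jp x) := x.toJordanDecomposition.posPart_finite

instance (x : SM) : IsFiniteMeasure (jn x) := x.toJordanDecomposition.negPart_finite

/-- A finite signed Borel measure on `ℝ̄` is symmetric iff both parts of its Jordan
decomposition are symmetric measures. -/
def IsSymm (x : SM) : Prop := IsSymmMeasure (jp x) ∧ IsSymmMeasure (jn x)

/-- Membership in `X`, the set of symmetric probability measures on `ℝ̄`. -/
def MemX (x : SM) : Prop :=
  (∃ (μ : Measure EReal) (hμ : IsProbabilityMeasure μ),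
      x = (letI := hμ; μ.toSignedMeasure)) ∧ IsSymm x

/-- Membership in `X_d`, the set of differences of symmetric probability measures. -/
def MemXd (y : SM) : Prop := ∃ x1 x2 : SM, MemX x1 ∧ MemX x2 ∧ y = x1 - x2

/-- Integral of a real function against a finite signed measure. -/
def sInt (f : EReal → ℝ) (x : SM) : ℝ := (∫ α, f α ∂(jp x)) - ∫ α, f α ∂(jn x)

/-- `tanh(α/2)` extended continuously to `ℝ̄`. -/
def tanhHalf (α : EReal) : ℝ :=
  if α = ⊤ then 1 else if α = ⊥ then -1 else Real.tanh (α.toReal / 2)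

/-- The inverse hyperbolic tangent on `(-1, 1)`. -/
def artanh (t : ℝ) : ℝ := Real.log ((1 + t) / (1 - t)) / 2

/-- `2 tanh⁻¹(t)` valued in `ℝ̄` (sending `t ≥ 1` to `+∞` and `t ≤ -1` to `-∞`). -/
def atanhTwo (t : ℝ) : EReal :=
  if 1 ≤ t then ⊤ else if t ≤ -1 then ⊥ else ((2 * artanh t : ℝ) : EReal)

/-- Variable-node convolution `⊛` of two (nonnegative) measures:
`(μ ⊛ ν)(E) = ∫ μ(E - α) ν(dα)`, i.e. the pushforward of `μ × ν` under addition. -/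
def mConv (μ ν : Measure EReal) : Measure EReal :=
  (μ.prod ν).map fun p => p.1 + p.2

/-- Check-node convolution `⊠` of two (nonnegative) measures:
`(μ ⊠ ν)(E) = ∫ μ(2 tanh⁻¹(tanh(E/2) / tanh(α/2))) ν(dα)`, where the argument of `μ`
is the image of `E` under `β ↦ 2 tanh⁻¹(tanh(β/2) / tanh(α/2))`; equivalently, the
pushforward of `μ × ν` under `(β, α) ↦ 2 tanh⁻¹(tanh(β/2) · tanh(α/2))`. -/
def mCheck (μ ν : Measure EReal) : Measure EReal :=
  (μ.prod ν).map fun p => atanhTwo (tanhHalf p.1 * tanhHalf p.2)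

instance (μ ν : Measure EReal) [IsFiniteMeasure μ] [IsFiniteMeasure ν] :
    IsFiniteMeasure (mConv μ ν) := by unfold mConv; infer_instance

instance (μ ν : Measure EReal) [IsFiniteMeasure μ] [IsFiniteMeasure ν] :
    IsFiniteMeasure (mCheck μ ν) := by unfold mCheck; infer_instance

/-- The variable-node operation `⊛` extended bilinearly to finite signed measures. -/
def sConv (x y : SM) : SM :=
  (mConv (jp x) (jp y)).toSignedMeasure - (mConv (jp x) (jn y)).toSignedMeasure
    - (mConv (jn x) (jp y)).toSignedMeasure + (mConv (jn x) (jn y)).toSignedMeasure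

/-- The check-node operation `⊠` extended bilinearly to finite signed measures. -/
def sCheck (x y : SM) : SM :=
  (mCheck (jp x) (jp y)).toSignedMeasure - (mCheck (jp x) (jn y)).toSignedMeasure
    - (mCheck (jn x) (jp y)).toSignedMeasure + (mCheck (jn x) (jn y)).toSignedMeasure

/-- The integrand `log₂(1 + e^{-α})` of the entropy functional (with the harmless
convention that it vanishes at `α = ±∞`; symmetric measures put no mass at `-∞`). -/
def entFn (α : EReal) : ℝ :=
  if α = ⊤ then 0 else if α = ⊥ then 0 else Real.logb 2 (1 + Real.exp (-(α.toReal)))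

/-- The entropy functional `H(x) = ∫ log₂(1 + e^{-α}) x(dα)`. -/
def H (x : SM) : ℝ := sInt entFn x

/-- `I_f(x) = ∫ f(|tanh(α/2)|) x(dα)`. -/
def If (f : ℝ → ℝ) (x : SM) : ℝ := sInt (fun α => f |tanhHalf α|) x

/-- `x1` is degraded with respect to `x2` (written `x1 ⪰ x2`): `I_f(x1) ≥ I_f(x2)` for
every concave non-increasing `f : [0,1] → ℝ`. -/
def Degraded (x1 x2 : SM) : Prop :=
  ∀ f : ℝ → ℝ, ConcaveOn ℝ (Set.Icc (0 : ℝ) 1) f → AntitoneOn f (Set.Icc (0 : ℝ) 1) →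
    If f x2 ≤ If f x1

/-- `x1` is strictly degraded with respect to `x2` (written `x1 ≻ x2`). -/
def StrictlyDegraded (x1 x2 : SM) : Prop :=
  Degraded x1 x2 ∧ ∃ f : ℝ → ℝ, ConcaveOn ℝ (Set.Icc (0 : ℝ) 1) f ∧
    AntitoneOn f (Set.Icc (0 : ℝ) 1) ∧ If f x2 < If f x1

/-- `Δ_0`, the unit point mass at `0`. -/
def d0 : SM := (Measure.dirac (0 : EReal)).toSignedMeasure

/-- `Δ_∞`, the unit point mass at `+∞`. -/
def dTop : SM := (Measure.dirac (⊤ : EReal)).toSignedMeasure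

/-- `x^{⊛n}` with `x^{⊛0} = Δ_0`. -/
def convPow (x : SM) : ℕ → SM
  | 0 => d0
  | n + 1 => sConv (convPow x n) x

/-- `x^{⊠n}` with `x^{⊠0} = Δ_∞`. -/
def checkPow (x : SM) : ℕ → SM
  | 0 => dTop
  | n + 1 => sCheck (checkPow x n) x

/-- `p^{⊛}(x) = Σ_n p_n x^{⊛n}` for a real polynomial `p`. -/
def polyConv (p : Polynomial ℝ) (x : SM) : SM :=
  ∑ n ∈ Finset.range (p.natDegree + 1), p.coeff n • convPow x n

/-- `p^{⊠}(x) = Σ_n p_n x^{⊠n}` for a real polynomial `p`. -/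
def polyCheck (p : Polynomial ℝ) (x : SM) : SM :=
  ∑ n ∈ Finset.range (p.natDegree + 1), p.coeff n • checkPow x n

/-- The single-system potential functional `U(x; c)` of the LDPC(λ, ρ) ensemble:
`U(x; c) = (L'(1)/R'(1)) H(R^⊠(x)) + L'(1) H(ρ^⊠(x)) - L'(1) H(x ⊠ ρ^⊠(x))
  - H(c ⊛ L^⊛(ρ^⊠(x)))`. -/
def potU (rho L R : Polynomial ℝ) (x c : SM) : ℝ :=
  (derivative L).eval 1 / (derivative R).eval 1 * H (polyCheck R x)
    + (derivative L).eval 1 * H (polyCheck rho x)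
    - (derivative L).eval 1 * H (sCheck x (polyCheck rho x))
    - H (sConv c (polyConv L (polyCheck rho x)))

/-- `1 - tanh(α/2)`. -/
def qm (α : EReal) : ENNReal := ENNReal.ofReal (1 - tanhHalf α)

/-- `1 + tanh(α/2)`. -/
def qp (α : EReal) : ENNReal := ENNReal.ofReal (1 + tanhHalf α)

lemma tanhHalf_top : tanhHalf ⊤ = 1 := by simp [tanhHalf]

lemma tanhHalf_bot : tanhHalf ⊥ = -1 := by simp [tanhHalf]

lemma tanhHalf_coe (a : ℝ) : tanhHalf (a : EReal) = Real.tanh (a / 2) := by simp [tanhHalf]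

lemma tanhHalf_neg (α : EReal) : tanhHalf (-α) = -tanhHalf α := by
  induction α with
  | bot => simp [tanhHalf_top, tanhHalf_bot]
  | top => simp [tanhHalf_top, tanhHalf_bot]
  | coe a => rw [← EReal.coe_neg, tanhHalf_coe, tanhHalf_coe, neg_div, Real.tanh_neg]

lemma tanhHalf_coe_lt (a : ℝ) : -1 < tanhHalf (a : EReal) ∧ tanhHalf (a : EReal) < 1 := by
  rw [tanhHalf_coe]; exact ⟨Real.neg_one_lt_tanh _, Real.tanh_lt_one _⟩

lemma tanhHalf_mem (α : EReal) : -1 ≤ tanhHalf α ∧ tanhHalf α ≤ 1 := by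
  induction α with
  | bot => simp [tanhHalf_bot]
  | top => simp [tanhHalf_top]
  | coe a => exact ⟨(tanhHalf_coe_lt a).1.le, (tanhHalf_coe_lt a).2.le⟩

lemma tanhHalf_abs_le (α : EReal) : |tanhHalf α| ≤ 1 := abs_le.2 (tanhHalf_mem α)

lemma measurable_tanhHalf : Measurable tanhHalf := by
  apply EReal.measurable_of_measurable_real
  simp only [tanhHalf_coe]
  have : Continuous fun a : ℝ => Real.tanh (a / 2) := by
    simp only [Real.tanh_eq_sinh_div_cosh]
    exact (Real.continuous_sinh.comp (continuous_id.div_const 2)).div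
      (Real.continuous_cosh.comp (continuous_id.div_const 2)) (fun x => (Real.cosh_pos _).ne')
  exact this.measurable

lemma measurable_qm : Measurable qm :=
  (measurable_const.sub measurable_tanhHalf).ennreal_ofReal

lemma measurable_qp : Measurable qp :=
  (measurable_const.add measurable_tanhHalf).ennreal_ofReal

lemma qm_add_qp (α : EReal) : qm α + qp α = 2 := by
  have := tanhHalf_mem α
  rw [qm, qp, ← ENNReal.ofReal_add (by linarith) (by linarith)]
  norm_num

lemma measurable_entFn : Measurable entFn := by
  apply EReal.measurable_of_measurable_real
  have : (fun p : ℝ => entFn (p : EReal)) = fun p => Real.logb 2 (1 + Real.exp (-p)) := by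
    funext p; simp [entFn]
  rw [this]
  simp only [Real.logb]
  fun_prop

lemma measurable_atanhTwo : Measurable atanhTwo := by
  unfold atanhTwo
  refine Measurable.ite measurableSet_Ici measurable_const ?_
  refine Measurable.ite measurableSet_Iic measurable_const ?_
  refine measurable_coe_real_ereal.comp ?_
  unfold artanh
  fun_prop

lemma atanhTwo_neg (T : ℝ) : atanhTwo (-T) = - atanhTwo T := by
  unfold atanhTwo
  by_cases h1 : 1 ≤ T
  · rw [if_neg (by linarith), if_pos (by linarith), if_pos h1]; simp
  · by_cases h2 : T ≤ -1
    · rw [if_pos (by linarith), if_neg h1, if_pos h2]; simp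
    · rw [if_neg (by linarith), if_neg (by linarith), if_neg h1, if_neg h2, ← EReal.coe_neg]
      congr 1
      unfold artanh
      rw [show (1 + -T) / (1 - -T) = ((1 + T) / (1 - T))⁻¹ by rw [inv_div]; ring, Real.log_inv]
      ring

lemma tanh_half_eq (a : ℝ) : Real.tanh (a / 2) = (1 - Real.exp (-a)) / (1 + Real.exp (-a)) := by
  rw [Real.tanh_eq]
  have h : Real.exp (-a) = Real.exp (-(a/2)) * Real.exp (-(a/2)) := by
    rw [← Real.exp_add]; ring_nf
  have h2 : Real.exp (a/2) * Real.exp (-(a/2)) = 1 := by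
    rw [← Real.exp_add]; simp
  have p1 := Real.exp_pos (a/2)
  have p2 := Real.exp_pos (-(a/2))
  rw [h, div_eq_div_iff (by positivity) (by positivity)]
  generalize Real.exp (a/2) = u at *
  generalize Real.exp (-(a/2)) = v at *
  linear_combination (2 * v) * h2

lemma tanhHalf_atanhTwo (T : ℝ) (h1 : -1 ≤ T) (h2 : T ≤ 1) : tanhHalf (atanhTwo T) = T := by
  unfold atanhTwo
  split_ifs with h3 h4
  · rw [tanhHalf_top]; linarith
  · rw [tanhHalf_bot]; linarith
  · push Not at h3 h4
    rw [tanhHalf_coe, tanh_half_eq]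
    have h5 : 0 < 1 + T := by linarith
    have h6 : 0 < 1 - T := by linarith
    have : Real.exp (-(2 * artanh T)) = (1 - T) / (1 + T) := by
      unfold artanh
      rw [show -(2 * (Real.log ((1 + T) / (1 - T)) / 2)) = Real.log (((1 + T) / (1 - T))⁻¹) by
        rw [Real.log_inv]; ring, Real.exp_log (by positivity), inv_div]
    rw [this]
    field_simp
    ring

/-- Bounded form of symmetry. -/
def Sy (μ : Measure EReal) : Prop :=
  ∀ φ : EReal → ENNReal, Measurable φ → ∫⁻ α, φ (-α) * qm α ∂μ = ∫⁻ α, φ α * qm α ∂μ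

lemma Sy.bot {μ : Measure EReal} (h : Sy μ) : μ {⊥} = 0 := by
  have h1 := h (Set.indicator {⊥} 1) (measurable_one.indicator (measurableSet_singleton _))
  have e1 : ∀ α : EReal, Set.indicator {⊥} (1 : EReal → ENNReal) (-α) * qm α = 0 := by
    intro α
    by_cases ha : α = ⊤
    · subst ha; simp [qm, tanhHalf_top]
    · have : -α ∉ ({⊥} : Set EReal) := by
        simpa [EReal.neg_eq_bot_iff] using ha
      simp [Set.indicator_of_notMem this]
  have e2 : ∀ α : EReal, Set.indicator {⊥} (1 : EReal → ENNReal) α * qm α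
      = Set.indicator {⊥} (fun _ => (2 : ENNReal)) α := by
    intro α
    by_cases ha : α = ⊥
    · subst ha; simp [qm, tanhHalf_bot]; norm_num
    · have : α ∉ ({⊥} : Set EReal) := by simpa using ha
      simp [Set.indicator_of_notMem this]
  simp only [e1, e2] at h1
  rw [lintegral_indicator_const (measurableSet_singleton _)] at h1
  simpa using h1.symm

lemma Sy.ae_ne_bot {μ : Measure EReal} (h : Sy μ) : ∀ᵐ α ∂μ, α ≠ ⊥ := by
  rw [ae_iff]; simpa using h.bot

lemma measurable_wt : Measurable wt := by
  unfold wt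
  refine Measurable.ite (measurableSet_singleton _) measurable_const ?_
  refine Measurable.ite (measurableSet_singleton _) measurable_const ?_
  exact ((measurable_ereal_toReal.neg.div_const 2).exp).ennreal_ofReal

lemma Sy_of_isSymm {μ : Measure EReal} (h : IsSymmMeasure μ) : Sy μ := by
  have hneg : Measurable (fun a : EReal => -a) := measurable_neg
  have hm : (μ.withDensity wt).map (fun a : EReal => -a) = μ.withDensity wt := by
    ext E hE
    rw [Measure.map_apply hneg hE, withDensity_apply _ (hneg hE), withDensity_apply _ hE]
    exact h E hE
  have hφ : ∀ φ : EReal → ENNReal, Measurable φ →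
      ∫⁻ α, wt α * φ (-α) ∂μ = ∫⁻ α, wt α * φ α ∂μ := by
    intro φ hφ
    have h1 := lintegral_map (μ := μ.withDensity wt) hφ hneg
    rw [hm, lintegral_withDensity_eq_lintegral_mul _ measurable_wt hφ,
      lintegral_withDensity_eq_lintegral_mul _ measurable_wt
        (show Measurable (fun a : EReal => φ (-a)) from hφ.comp hneg)] at h1
    exact h1.symm
  have hbot : μ {⊥} = 0 := by
    have h1 := h {⊤} (measurableSet_singleton _)
    have : (fun a : EReal => -a) ⁻¹' {⊤} = {⊥} := by
      ext a; simp [EReal.neg_eq_top_iff]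
    rw [this] at h1
    simpa [wt] using h1
  have hae : ∀ᵐ α ∂μ, α ≠ ⊥ := by rw [ae_iff]; simpa using hbot
  let κ : EReal → ENNReal := fun α => if α = ⊥ then 0 else if α = ⊤ then 0 else
    ENNReal.ofReal (1 / Real.cosh (α.toReal / 2))
  have hκ : Measurable κ := by
    refine Measurable.ite (measurableSet_singleton _) measurable_const ?_
    refine Measurable.ite (measurableSet_singleton _) measurable_const ?_
    exact (measurable_const.div (measurable_ereal_toReal.div_const 2).cosh).ennreal_ofReal
  have hκn : ∀ α, κ (-α) = κ α := by
    intro α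
    induction α with
    | bot => simp [κ]
    | top => simp [κ]
    | coe a => rw [← EReal.coe_neg]; simp [κ, neg_div]
  have hκw : ∀ α, α ≠ ⊥ → wt α * κ α = qm α := by
    intro α ha
    induction α with
    | bot => simp at ha
    | top => simp [κ, qm, tanhHalf_top]
    | coe a =>
      simp only [wt, κ, qm, tanhHalf_coe, EReal.coe_ne_bot, EReal.coe_ne_top, if_false,
        EReal.toReal_coe]
      rw [← ENNReal.ofReal_mul (Real.exp_pos _).le]
      congr 1
      have hc := Real.cosh_pos (a/2)
      rw [Real.tanh_eq_sinh_div_cosh, neg_div, ← Real.cosh_sub_sinh]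
      field_simp
  intro φ hφm
  have := hφ (fun α => κ α * φ α) (hκ.mul hφm)
  calc ∫⁻ α, φ (-α) * qm α ∂μ = ∫⁻ α, wt α * (κ (-α) * φ (-α)) ∂μ := by
        apply lintegral_congr_ae
        filter_upwards [hae] with α ha
        rw [hκn, ← mul_assoc, hκw α ha, mul_comm]
    _ = ∫⁻ α, wt α * (κ α * φ α) ∂μ := this
    _ = _ := by
        apply lintegral_congr_ae
        filter_upwards [hae] with α ha
        rw [← mul_assoc, hκw α ha, mul_comm]

section flips
variable {μ ν : Measure EReal} [IsFiniteMeasure μ] [IsFiniteMeasure ν]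

lemma flipL (h : Sy μ) (Ψ : EReal × EReal → ENNReal) (hΨ : Measurable Ψ) :
    ∫⁻ p, Ψ (-p.1, p.2) * qm p.1 ∂(μ.prod ν) = ∫⁻ p, Ψ p * qm p.1 ∂(μ.prod ν) := by
  have hq := measurable_qm
  rw [lintegral_prod_symm _ (by fun_prop), lintegral_prod_symm _ (by fun_prop)]
  refine lintegral_congr fun b => ?_
  exact h (fun a => Ψ (a, b)) (by fun_prop)

lemma flipR (h : Sy ν) (Ψ : EReal × EReal → ENNReal) (hΨ : Measurable Ψ) :
    ∫⁻ p, Ψ (p.1, -p.2) * qm p.2 ∂(μ.prod ν) = ∫⁻ p, Ψ p * qm p.2 ∂(μ.prod ν) := by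
  have hq := measurable_qm
  rw [lintegral_prod _ (by fun_prop), lintegral_prod _ (by fun_prop)]
  refine lintegral_congr fun b => ?_
  exact h (fun a => Ψ (b, a)) (by fun_prop)

lemma symL (h : Sy μ) (Ψ : EReal × EReal → ENNReal) (hΨ : Measurable Ψ) :
    2 * ∫⁻ p, Ψ p ∂(μ.prod ν)
      = ∫⁻ p, (Ψ (-p.1, p.2) * qm p.1 + Ψ p * qp p.1) ∂(μ.prod ν) := by
  have hq := measurable_qm
  have hq' := measurable_qp
  rw [lintegral_add_left (by fun_prop), flipL h Ψ hΨ, ← lintegral_add_left (by fun_prop),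
    ← lintegral_const_mul _ hΨ]
  refine lintegral_congr fun p => ?_
  rw [← mul_add, qm_add_qp, mul_comm]

lemma symR (h : Sy ν) (Ψ : EReal × EReal → ENNReal) (hΨ : Measurable Ψ) :
    2 * ∫⁻ p, Ψ p ∂(μ.prod ν)
      = ∫⁻ p, (Ψ (p.1, -p.2) * qm p.2 + Ψ p * qp p.2) ∂(μ.prod ν) := by
  have hq := measurable_qm
  have hq' := measurable_qp
  rw [lintegral_add_left (by fun_prop), flipR h Ψ hΨ, ← lintegral_add_left (by fun_prop),
    ← lintegral_const_mul _ hΨ]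
  refine lintegral_congr fun p => ?_
  rw [← mul_add, qm_add_qp, mul_comm]

lemma measurable_checkMap :
    Measurable fun p : EReal × EReal => atanhTwo (tanhHalf p.1 * tanhHalf p.2) :=
  measurable_atanhTwo.comp ((measurable_tanhHalf.comp measurable_fst).mul
    (measurable_tanhHalf.comp measurable_snd))

lemma mul_mem_bd {t s : ℝ} (ht : -1 ≤ t ∧ t ≤ 1) (hs : -1 ≤ s ∧ s ≤ 1) :
    -1 ≤ t * s ∧ t * s ≤ 1 := by
  constructor <;> nlinarith [ht.1, ht.2, hs.1, hs.2]

lemma two_qm_check (a b : EReal) : 2 * qm (atanhTwo (tanhHalf a * tanhHalf b))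
    = qp b * qm a + qp a * qm b := by
  have ha := tanhHalf_mem a
  have hb := tanhHalf_mem b
  have hab := mul_mem_bd ha hb
  unfold qm qp
  rw [tanhHalf_atanhTwo _ hab.1 hab.2]
  rw [← ENNReal.ofReal_mul (by linarith), ← ENNReal.ofReal_mul (by linarith),
    ← ENNReal.ofReal_add (mul_nonneg (by linarith) (by linarith))
      (mul_nonneg (by linarith) (by linarith)),
    show (2 : ENNReal) = ENNReal.ofReal 2 by norm_num, ← ENNReal.ofReal_mul (by norm_num)]
  congr 1; ring

lemma Sy.check (h : Sy μ) (h' : Sy ν) : Sy (mCheck μ ν) := by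
  intro φ hφ
  have hq := measurable_qm
  have hq' := measurable_qp
  have hc := measurable_checkMap
  unfold mCheck
  rw [lintegral_map (by fun_prop) hc, lintegral_map (by fun_prop) hc]
  have two : (2 : ENNReal) ≠ 0 := by norm_num
  have two' : (2 : ENNReal) ≠ ⊤ := by norm_num
  rw [← ENNReal.mul_right_inj two two', ← lintegral_const_mul _ (by fun_prop),
    ← lintegral_const_mul _ (by fun_prop)]
  have e : ∀ ψ : EReal → ENNReal, ∀ p : EReal × EReal,
      2 * (ψ (atanhTwo (tanhHalf p.1 * tanhHalf p.2)) * qm (atanhTwo (tanhHalf p.1 * tanhHalf p.2)))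
      = (ψ (atanhTwo (tanhHalf p.1 * tanhHalf p.2)) * qp p.2) * qm p.1 +
        (ψ (atanhTwo (tanhHalf p.1 * tanhHalf p.2)) * qp p.1) * qm p.2 := by
    intro ψ p
    rw [mul_left_comm, two_qm_check]; ring
  rw [lintegral_congr (e φ), lintegral_congr (e (fun a => φ (-a)))]
  rw [lintegral_add_left (by fun_prop), lintegral_add_left (by fun_prop)]
  congr 1
  · rw [← flipL h (fun p => φ (atanhTwo (tanhHalf p.1 * tanhHalf p.2)) * qp p.2) (by fun_prop)]
    refine lintegral_congr fun p => ?_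
    simp only [tanhHalf_neg, neg_mul, atanhTwo_neg]
  · rw [← flipR h' (fun p => φ (atanhTwo (tanhHalf p.1 * tanhHalf p.2)) * qp p.1) (by fun_prop)]
    refine lintegral_congr fun p => ?_
    simp only [tanhHalf_neg, mul_neg, atanhTwo_neg]

lemma tanhHalf_add (a b : ℝ) : tanhHalf ((a : EReal) + b) =
    (tanhHalf a + tanhHalf b) / (1 + tanhHalf a * tanhHalf b) := by
  rw [← EReal.coe_add, tanhHalf_coe, tanhHalf_coe, tanhHalf_coe, tanh_half_eq, tanh_half_eq,
    tanh_half_eq, neg_add, Real.exp_add]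
  have p1 := Real.exp_pos (-a)
  have p2 := Real.exp_pos (-b)
  generalize Real.exp (-a) = u at *
  generalize Real.exp (-b) = v at *
  have h1 : (1 + u) ≠ 0 := by positivity
  have h2 : (1 + v) ≠ 0 := by positivity
  have h3 : 1 + (1 - u) / (1 + u) * ((1 - v) / (1 + v)) = 2 * (1 + u * v) / ((1 + u) * (1 + v)) := by
    field_simp; ring
  have h4 : 1 + u * v ≠ 0 := by positivity
  rw [h3]
  field_simp
  ring

lemma Sy.conv (h : Sy μ) (h' : Sy ν) : Sy (mConv μ ν) := by
  intro φ hφ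
  have hq := measurable_qm
  have hq' := measurable_qp
  have ht := measurable_tanhHalf
  unfold mConv
  rw [lintegral_map (by fun_prop) (by fun_prop), lintegral_map (by fun_prop) (by fun_prop)]
  let r : EReal × EReal → ENNReal := fun p =>
    ENNReal.ofReal (1 / (1 + tanhHalf p.1 * tanhHalf p.2))
  have hr : Measurable r := by fun_prop
  have hrn : ∀ a b, r (-a, -b) = r (a, b) := by
    intro a b; simp [r, tanhHalf_neg]
  have hae : ∀ᵐ p ∂(μ.prod ν), p.1 ≠ ⊥ ∧ p.2 ≠ ⊥ := by
    have h1 : ∀ᵐ p ∂(μ.prod ν), p.1 ≠ ⊥ :=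
      Measure.quasiMeasurePreserving_fst.ae h.ae_ne_bot
    have h2 : ∀ᵐ p ∂(μ.prod ν), p.2 ≠ ⊥ :=
      Measure.quasiMeasurePreserving_snd.ae h'.ae_ne_bot
    exact h1.and h2
  have key : ∀ a b : EReal, a ≠ ⊥ → b ≠ ⊥ → qm (a + b) = r (a, b) * qm a * qm b := by
    intro a b ha hb
    induction a with
    | bot => simp at ha
    | top => rw [EReal.top_add_of_ne_bot hb]; simp [qm, tanhHalf_top]
    | coe a =>
      induction b with
      | bot => simp at hb
      | top => rw [EReal.coe_add_top]; simp [qm, tanhHalf_top]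
      | coe b =>
        have h1 := tanhHalf_coe_lt a
        have h2 := tanhHalf_coe_lt b
        simp only [qm, r]
        rw [tanhHalf_add]
        generalize tanhHalf (a : EReal) = t at *
        generalize tanhHalf (b : EReal) = s at *
        have h3 : 0 < 1 + t * s := by nlinarith
        rw [← ENNReal.ofReal_mul (by positivity),
          ← ENNReal.ofReal_mul (mul_nonneg (by positivity) (by linarith))]
        congr 1
        field_simp
        ring
  calc ∫⁻ p, φ (-(p.1 + p.2)) * qm (p.1 + p.2) ∂(μ.prod ν)
      = ∫⁻ p, (φ (-p.1 + -p.2) * r (-p.1, -p.2) * qm p.2) * qm p.1 ∂(μ.prod ν) := by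
        apply lintegral_congr_ae
        filter_upwards [hae] with p hp
        rw [key _ _ hp.1 hp.2, hrn, EReal.neg_add (Or.inl hp.1) (Or.inr hp.2), sub_eq_add_neg]
        ring
    _ = ∫⁻ p, (φ (p.1 + -p.2) * r (p.1, -p.2) * qm p.2) * qm p.1 ∂(μ.prod ν) :=
        flipL h (fun p => φ (p.1 + -p.2) * r (p.1, -p.2) * qm p.2) (by fun_prop)
    _ = ∫⁻ p, (φ (p.1 + -p.2) * r (p.1, -p.2) * qm p.1) * qm p.2 ∂(μ.prod ν) :=
        lintegral_congr fun p => by ring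
    _ = ∫⁻ p, (φ (p.1 + p.2) * r (p.1, p.2) * qm p.1) * qm p.2 ∂(μ.prod ν) :=
        flipR h' (fun p => φ (p.1 + p.2) * r (p.1, p.2) * qm p.1) (by fun_prop)
    _ = _ := by
        apply lintegral_congr_ae
        filter_upwards [hae] with p hp
        rw [key _ _ hp.1 hp.2]
        ring

end flips
/-- `((1+t) log(1+t) + (1-t) log(1-t))/2`. -/
def hh (t : ℝ) : ℝ := ((1 + t) * Real.log (1 + t) + (1 - t) * Real.log (1 - t)) / 2

/-- Coefficients of the power series of `hh`. -/
def ak (k : ℕ) : ℝ := 1 / (2 * k + 1) - 1 / (2 * k + 2)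

lemma ak_pos (k : ℕ) : 0 < ak k := by
  unfold ak
  rw [sub_pos]
  apply one_div_lt_one_div_of_lt <;> [positivity; linarith]

lemma continuous_hh : Continuous hh := by
  unfold hh
  have h1 : Continuous fun t : ℝ => (1 + t) * Real.log (1 + t) :=
    Real.continuous_mul_log.comp (continuous_const.add continuous_id)
  have h2 : Continuous fun t : ℝ => (1 - t) * Real.log (1 - t) :=
    Real.continuous_mul_log.comp (continuous_const.sub continuous_id)
  exact (h1.add h2).div_const 2

lemma summable_ak : Summable ak := by
  have h1 : Summable fun k : ℕ => 1 / ((k + 1 : ℕ) : ℝ) ^ 2 :=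
    (summable_nat_add_iff 1).2 (Real.summable_one_div_nat_pow.2 one_lt_two)
  refine Summable.of_nonneg_of_le (fun k => (ak_pos k).le) (fun k => ?_) h1
  unfold ak
  have hk : (0 : ℝ) ≤ k := by positivity
  rw [div_sub_div _ _ (by positivity) (by positivity), div_le_div_iff₀ (by positivity)
    (by positivity)]
  push_cast
  nlinarith

lemma hasSum_hh_lt {t : ℝ} (ht : |t| < 1) : HasSum (fun k => ak k * t ^ (2 * (k + 1))) (hh t) := by
  have h1 := (Real.hasSum_log_sub_log_of_abs_lt_one ht).mul_left t
  have ht2 : |t ^ 2| < 1 := by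
    rw [abs_pow]; exact pow_lt_one₀ (abs_nonneg _) ht two_ne_zero
  have h2 := Real.hasSum_pow_div_log_of_abs_lt_one ht2
  have h3 := (h1.sub h2).div_const 2
  obtain ⟨hl, hu⟩ := abs_lt.1 ht
  have e1 : (fun k : ℕ => ak k * t ^ (2 * (k + 1))) = fun i : ℕ =>
      (t * (2 * (1 / (2 * (i : ℝ) + 1)) * t ^ (2 * i + 1)) - (t ^ 2) ^ (i + 1) / ((i : ℝ) + 1)) / 2 := by
    funext k
    unfold ak
    have hk : (0 : ℝ) ≤ k := by positivity
    rw [← pow_mul]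
    field_simp
    ring
  have e2 : hh t = (t * (Real.log (1 + t) - Real.log (1 - t)) - -Real.log (1 - t ^ 2)) / 2 := by
    rw [show 1 - t ^ 2 = (1 + t) * (1 - t) by ring, Real.log_mul (by linarith) (by linarith)]
    unfold hh
    ring
  rw [e1, e2]
  exact h3

lemma term_bound {t : ℝ} (ht : |t| ≤ 1) (k : ℕ) : ‖ak k * t ^ (2 * (k + 1))‖ ≤ ak k := by
  rw [norm_mul, Real.norm_of_nonneg (ak_pos k).le, norm_pow, Real.norm_eq_abs]
  exact mul_le_of_le_one_right (ak_pos k).le (pow_le_one₀ (abs_nonneg _) ht)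

lemma hasSum_hh {t : ℝ} (ht : |t| ≤ 1) : HasSum (fun k => ak k * t ^ (2 * (k + 1))) (hh t) := by
  have hsum : ∀ t : ℝ, |t| ≤ 1 → Summable (fun k => ak k * t ^ (2 * (k + 1))) := fun t ht =>
    Summable.of_norm_bounded summable_ak (term_bound ht)
  have hc : ContinuousOn (fun t : ℝ => ∑' k, ak k * t ^ (2 * (k + 1))) (Set.Icc (-1) 1) := by
    refine continuousOn_tsum (u := ak) (fun k => ?_) summable_ak ?_
    · fun_prop
    · intro k t ht
      exact term_bound (abs_le.2 ht) k
  have heq : Set.EqOn (fun t : ℝ => ∑' k, ak k * t ^ (2 * (k + 1))) hh (Set.Icc (-1) 1) := by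
    have hcl : closure (Set.Ioo (-1 : ℝ) 1) = Set.Icc (-1) 1 := closure_Ioo (by norm_num)
    refine Set.EqOn.of_subset_closure (s := Set.Ioo (-1 : ℝ) 1) ?_ hc continuous_hh.continuousOn
      Set.Ioo_subset_Icc_self hcl.ge
    intro t ht
    exact (hasSum_hh_lt (abs_lt.2 ht)).tsum_eq
  have := (hsum t ht).hasSum
  rwa [show (∑' k, ak k * t ^ (2 * (k + 1))) = hh t from heq (abs_le.1 ht)] at this

lemma hh_neg (t : ℝ) : hh (-t) = hh t := by unfold hh; ring_nf

lemma hh_one : hh 1 = Real.log 2 := by unfold hh; norm_num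

lemma entFn_nonneg (α : EReal) : 0 ≤ entFn α := by
  unfold entFn
  split_ifs
  · exact le_rfl
  · exact le_rfl
  · exact Real.logb_nonneg one_lt_two (by have := Real.exp_pos (-α.toReal); linarith)

lemma entFn_add (a b : ℝ) : entFn ((a : EReal) + b) =
    (Real.log 2 + Real.log (1 + tanhHalf a * tanhHalf b) - Real.log (1 + tanhHalf a)
      - Real.log (1 + tanhHalf b)) / Real.log 2 := by
  rw [← EReal.coe_add]
  simp only [entFn, EReal.coe_ne_top, EReal.coe_ne_bot, if_false, EReal.toReal_coe]
  unfold Real.logb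
  congr 1
  have h1 := tanhHalf_coe_lt a
  have h2 := tanhHalf_coe_lt b
  have e1 : Real.exp (-a) = (1 - tanhHalf a) / (1 + tanhHalf a) := by
    rw [tanhHalf_coe, tanh_half_eq]
    have := Real.exp_pos (-a)
    field_simp
    ring
  have e2 : Real.exp (-b) = (1 - tanhHalf b) / (1 + tanhHalf b) := by
    rw [tanhHalf_coe, tanh_half_eq]
    have := Real.exp_pos (-b)
    field_simp
    ring
  rw [neg_add, Real.exp_add, e1, e2]
  generalize tanhHalf (a : EReal) = t at *
  generalize tanhHalf (b : EReal) = s at *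
  have p1 : 0 < 1 + t := by linarith
  have p2 : 0 < 1 + s := by linarith
  have p3 : 0 < 1 + t * s := by nlinarith
  have : 1 + (1 - t) / (1 + t) * ((1 - s) / (1 + s))
      = 2 * (1 + t * s) / ((1 + t) * (1 + s)) := by
    field_simp
    ring
  rw [this, Real.log_div (by positivity) (by positivity), Real.log_mul (by norm_num) p3.ne',
    Real.log_mul p1.ne' p2.ne']
  ring

/-- The symmetrised kernel. -/
def kk (t s : ℝ) : ℝ := 1 - (hh t + hh s - hh (t * s)) / Real.log 2

lemma kk_eq (α β : EReal) :
    entFn (-α + -β) * (1 - tanhHalf α) * (1 - tanhHalf β)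
    + entFn (-α + β) * (1 - tanhHalf α) * (1 + tanhHalf β)
    + entFn (α + -β) * (1 + tanhHalf α) * (1 - tanhHalf β)
    + entFn (α + β) * (1 + tanhHalf α) * (1 + tanhHalf β)
    = 4 * kk (tanhHalf α) (tanhHalf β) := by
  have hl : Real.log 2 ≠ 0 := (Real.log_pos one_lt_two).ne'
  have et : ∀ γ : EReal, entFn (⊤ + γ) = 0 := by
    intro γ
    induction γ with
    | bot => simp [entFn]
    | top => simp [entFn]
    | coe a => simp [entFn]
  have et' : ∀ γ : EReal, entFn (γ + ⊤) = 0 := fun γ => by rw [add_comm]; exact et γ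
  have et0 : entFn ⊤ = 0 := by simp [entFn]
  induction α with
  | bot => simp [tanhHalf_bot, et, et0, kk, hh_neg, hh_one, hl]
  | top => simp [tanhHalf_top, et, et0, kk, hh_one, hl]
  | coe a =>
    induction β with
    | bot => simp [tanhHalf_bot, et', et0, kk, hh_neg, hh_one, hl]
    | top => simp [tanhHalf_top, et', et0, kk, hh_one, hl]
    | coe b =>
      simp only [← EReal.coe_neg]
      rw [entFn_add, entFn_add, entFn_add, entFn_add]
      simp only [EReal.coe_neg, tanhHalf_neg]
      generalize tanhHalf (a : EReal) = t
      generalize tanhHalf (b : EReal) = s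
      unfold kk hh
      field_simp
      ring_nf

lemma measurable_kk : Measurable fun p : EReal × EReal => kk (tanhHalf p.1) (tanhHalf p.2) := by
  have h1 := continuous_hh.measurable
  have h2 := measurable_tanhHalf
  unfold kk
  fun_prop

lemma kk_nonneg (α β : EReal) : 0 ≤ kk (tanhHalf α) (tanhHalf β) := by
  have h := kk_eq α β
  have h1 := tanhHalf_mem α
  have h2 := tanhHalf_mem β
  have a1 : 0 ≤ 1 - tanhHalf α := by linarith
  have a2 : 0 ≤ 1 + tanhHalf α := by linarith
  have a3 : 0 ≤ 1 - tanhHalf β := by linarith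
  have a4 : 0 ≤ 1 + tanhHalf β := by linarith
  have e := entFn_nonneg
  have b1 := mul_nonneg (mul_nonneg (e (-α + -β)) a1) a3
  have b2 := mul_nonneg (mul_nonneg (e (-α + β)) a1) a4
  have b3 := mul_nonneg (mul_nonneg (e (α + -β)) a2) a3
  have b4 := mul_nonneg (mul_nonneg (e (α + β)) a2) a4
  linarith

lemma ent_conv {μ ν : Measure EReal} [IsFiniteMeasure μ] [IsFiniteMeasure ν]
    (h : Sy μ) (h' : Sy ν) :
    ∫ α, entFn α ∂(mConv μ ν) = ∫ p, kk (tanhHalf p.1) (tanhHalf p.2) ∂(μ.prod ν) := by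
  have me := measurable_entFn
  have hq := measurable_qm
  have hq' := measurable_qp
  unfold mConv
  rw [integral_map (by fun_prop) me.aestronglyMeasurable]
  rw [integral_eq_lintegral_of_nonneg_ae (Eventually.of_forall fun p => entFn_nonneg _)
    (by fun_prop : Measurable fun p : EReal × EReal => entFn (p.1 + p.2)).aestronglyMeasurable,
    integral_eq_lintegral_of_nonneg_ae (Eventually.of_forall fun p => kk_nonneg _ _)
    measurable_kk.aestronglyMeasurable]
  congr 1
  have two : (2 : ENNReal) ≠ 0 := by norm_num
  have two' : (2 : ENNReal) ≠ ⊤ := by norm_num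
  let F : EReal × EReal → ENNReal := fun p => ENNReal.ofReal (entFn (p.1 + p.2))
  have hF : Measurable F := by fun_prop
  have e1 := symL (μ := μ) (ν := ν) h F hF
  have e2 := symR (μ := μ) (ν := ν) h' (fun p => F (-p.1, p.2) * qm p.1 + F p * qp p.1)
    (by fun_prop)
  rw [← ENNReal.mul_right_inj two two', ← ENNReal.mul_right_inj two two', e1, e2,
    ← lintegral_const_mul _ measurable_kk.ennreal_ofReal,
    ← lintegral_const_mul _ (measurable_kk.ennreal_ofReal.const_mul _)]
  refine lintegral_congr fun p => ?_
  obtain ⟨α, β⟩ := p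
  have h1 := tanhHalf_mem α
  have h2 := tanhHalf_mem β
  have a1 : 0 ≤ 1 - tanhHalf α := by linarith
  have a2 : 0 ≤ 1 + tanhHalf α := by linarith
  have a3 : 0 ≤ 1 - tanhHalf β := by linarith
  have a4 : 0 ≤ 1 + tanhHalf β := by linarith
  have e := entFn_nonneg
  have b1 := mul_nonneg (mul_nonneg (e (-α + -β)) a1) a3
  have b2 := mul_nonneg (mul_nonneg (e (-α + β)) a1) a4
  have b3 := mul_nonneg (mul_nonneg (e (α + -β)) a2) a3
  have b4 := mul_nonneg (mul_nonneg (e (α + β)) a2) a4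
  have key := congrArg ENNReal.ofReal (kk_eq α β)
  rw [ENNReal.ofReal_add (by positivity) b4, ENNReal.ofReal_add (by positivity) b3,
    ENNReal.ofReal_add b1 b2, ENNReal.ofReal_mul (mul_nonneg (e _) a1),
    ENNReal.ofReal_mul (mul_nonneg (e _) a1), ENNReal.ofReal_mul (mul_nonneg (e _) a2),
    ENNReal.ofReal_mul (mul_nonneg (e _) a2), ENNReal.ofReal_mul (e _),
    ENNReal.ofReal_mul (e _), ENNReal.ofReal_mul (e _), ENNReal.ofReal_mul (e _),
    ENNReal.ofReal_mul (by norm_num)] at key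
  simp only [F, qm, qp]
  rw [← mul_assoc, show (2 : ENNReal) * 2 = ENNReal.ofReal 4 by norm_num, ← key]
  ring

/-- Even moments. -/
def Mk (μ : Measure EReal) (k : ℕ) : ℝ := ∫ α, tanhHalf α ^ (2 * (k + 1)) ∂μ

lemma abs_pow_le_one (α : EReal) (n : ℕ) : ‖tanhHalf α ^ n‖ ≤ 1 := by
  rw [norm_pow, Real.norm_eq_abs]
  exact pow_le_one₀ (abs_nonneg _) (tanhHalf_abs_le α)

lemma integrable_pow (μ : Measure EReal) [IsFiniteMeasure μ] (n : ℕ) :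
    Integrable (fun α => tanhHalf α ^ n) μ :=
  Integrable.of_bound (measurable_tanhHalf.pow_const n).aestronglyMeasurable 1
    (Eventually.of_forall fun α => abs_pow_le_one α n)

lemma hasSum_D (μ ν : Measure EReal) [IsFiniteMeasure μ] [IsFiniteMeasure ν] :
    HasSum (fun k => ak k * Mk μ k * ∫ β, (1 - tanhHalf β ^ (2 * (k + 1))) ∂ν)
      (∫ p, (hh (tanhHalf p.1) - hh (tanhHalf p.1 * tanhHalf p.2)) ∂(μ.prod ν)) := by
  have ht := measurable_tanhHalf
  have hprod : ∀ k, ∫ p, ak k * tanhHalf p.1 ^ (2 * (k + 1)) *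
      (1 - tanhHalf p.2 ^ (2 * (k + 1))) ∂(μ.prod ν) =
      ak k * Mk μ k * ∫ β, (1 - tanhHalf β ^ (2 * (k + 1))) ∂ν := by
    intro k
    rw [integral_prod_mul (fun α => ak k * tanhHalf α ^ (2 * (k + 1)))
      (fun β => 1 - tanhHalf β ^ (2 * (k + 1))), integral_const_mul, Mk]
  have h := hasSum_integral_of_dominated_convergence (μ := μ.prod ν)
    (F := fun (k : ℕ) (p : EReal × EReal) =>
      ak k * tanhHalf p.1 ^ (2 * (k + 1)) * (1 - tanhHalf p.2 ^ (2 * (k + 1))))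
    (f := fun p => hh (tanhHalf p.1) - hh (tanhHalf p.1 * tanhHalf p.2))
    (bound := fun k _ => ak k) ?_ ?_ ?_ ?_ ?_
  · have e : (fun k => ak k * Mk μ k * ∫ β, (1 - tanhHalf β ^ (2 * (k + 1))) ∂ν) =
        fun k => ∫ p, ak k * tanhHalf p.1 ^ (2 * (k + 1)) *
          (1 - tanhHalf p.2 ^ (2 * (k + 1))) ∂(μ.prod ν) := by
      funext k
      exact (hprod k).symm
    rw [e]
    exact h
  · intro k
    exact Measurable.aestronglyMeasurable (by fun_prop)
  · intro k
    refine Eventually.of_forall fun p => ?_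
    rw [norm_mul]
    have h1 := term_bound (tanhHalf_abs_le p.1) k
    have h2 : ‖1 - tanhHalf p.2 ^ (2 * (k + 1))‖ ≤ 1 := by
      have h3 := abs_pow_le_one p.2 (2 * (k + 1))
      have h4 : 0 ≤ tanhHalf p.2 ^ (2 * (k + 1)) := by rw [pow_mul]; positivity
      rw [Real.norm_of_nonneg h4] at h3
      rw [Real.norm_of_nonneg (by linarith)]
      linarith
    calc _ ≤ ak k * 1 := mul_le_mul h1 h2 (norm_nonneg _) (ak_pos k).le
      _ = _ := mul_one _
  · exact Eventually.of_forall fun p => summable_ak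
  · exact integrable_const _
  · refine Eventually.of_forall fun p => ?_
    have h1 := hasSum_hh (tanhHalf_abs_le p.1)
    have h2 := hasSum_hh (t := tanhHalf p.1 * tanhHalf p.2)
      (abs_le.2 (mul_mem_bd (tanhHalf_mem _) (tanhHalf_mem _)))
    have h3 := h1.sub h2
    have e : (fun k : ℕ => ak k * tanhHalf p.1 ^ (2 * (k + 1)) *
        (1 - tanhHalf p.2 ^ (2 * (k + 1)))) = fun k : ℕ => ak k * tanhHalf p.1 ^ (2 * (k + 1))
          - ak k * (tanhHalf p.1 * tanhHalf p.2) ^ (2 * (k + 1)) := by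
      funext k
      rw [mul_pow]; ring
    rw [e]
    exact h3

lemma ent_diff {μ ν : Measure EReal} [IsProbabilityMeasure μ] [IsFiniteMeasure ν] :
    ∫ p, kk (tanhHalf p.1) (tanhHalf p.2) ∂(μ.prod ν) =
      (∫ β, (1 - hh (tanhHalf β) / Real.log 2) ∂ν) -
      (∫ p, (hh (tanhHalf p.1) - hh (tanhHalf p.1 * tanhHalf p.2)) ∂(μ.prod ν)) / Real.log 2 := by
  have ht := measurable_tanhHalf
  have hm := continuous_hh.measurable
  obtain ⟨C, hC⟩ := isCompact_Icc.exists_bound_of_continuousOn (s := Set.Icc (-1 : ℝ) 1)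
    continuous_hh.continuousOn
  have i1 : Integrable (fun β => 1 - hh (tanhHalf β) / Real.log 2) ν :=
    (integrable_const _).sub ((Integrable.of_bound (hm.comp ht).aestronglyMeasurable C
      (Eventually.of_forall fun α => hC _ (tanhHalf_mem α))).div_const _)
  have i2 : Integrable (fun p : EReal × EReal =>
      hh (tanhHalf p.1) - hh (tanhHalf p.1 * tanhHalf p.2)) (μ.prod ν) := by
    refine Integrable.sub ?_ ?_
    · exact Integrable.of_bound (Measurable.aestronglyMeasurable (by fun_prop)) C
        (Eventually.of_forall fun p => hC _ (tanhHalf_mem _))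
    · exact Integrable.of_bound (Measurable.aestronglyMeasurable (by fun_prop)) C
        (Eventually.of_forall fun p => hC _ (mul_mem_bd (tanhHalf_mem _) (tanhHalf_mem _)))
  have e1 : ∫ β, (1 - hh (tanhHalf β) / Real.log 2) ∂ν
      = ∫ p, (1 - hh (tanhHalf p.2) / Real.log 2) ∂(μ.prod ν) := by
    have := integral_fun_snd (μ := μ) (ν := ν) (fun β => 1 - hh (tanhHalf β) / Real.log 2)
    rw [this]; simp
  rw [e1, ← integral_div, ← integral_sub (i1.comp_snd μ) (i2.div_const _)]
  refine integral_congr_ae (Eventually.of_forall fun p => ?_)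
  simp only [kk]
  ring

/-- Not concentrated at `+∞`. -/
def NT (μ : Measure EReal) : Prop := μ {⊤}ᶜ ≠ 0

lemma NT.pos {ν : Measure EReal} [IsFiniteMeasure ν] (h : NT ν) (hs : Sy ν) (k : ℕ) :
    0 < ∫ β, (1 - tanhHalf β ^ (2 * (k + 1))) ∂ν := by
  have hnn : ∀ β, 0 ≤ 1 - tanhHalf β ^ (2 * (k + 1)) := by
    intro β
    have h3 := abs_pow_le_one β (2 * (k + 1))
    have := le_abs_self (tanhHalf β ^ (2 * (k + 1)))
    rw [Real.norm_eq_abs] at h3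
    linarith
  rw [integral_pos_iff_support_of_nonneg hnn ((integrable_const _).sub (integrable_pow ν _))]
  have hsub : ({⊤}ᶜ : Set EReal) ⊆
      (Function.support fun β => 1 - tanhHalf β ^ (2 * (k + 1))) ∪ {⊥} := by
    intro β hβ
    by_cases hb : β = ⊥
    · right; exact hb
    · left
      induction β with
      | bot => simp at hb
      | top => simp at hβ
      | coe a =>
        have h1 := tanhHalf_coe_lt a
        have : |tanhHalf a| ^ (2 * (k + 1)) < 1 :=
          pow_lt_one₀ (abs_nonneg _) (abs_lt.2 h1) (by omega)
        rw [← abs_pow] at this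
        have h2 := le_abs_self (tanhHalf a ^ (2 * (k + 1)))
        simp only [Function.mem_support]
        linarith
  rw [pos_iff_ne_zero]
  intro h0
  apply h
  exact measure_mono_null hsub (measure_union_null h0 hs.bot)
lemma jordan_pos (μ : Measure EReal) [IsFiniteMeasure μ] :
    jp μ.toSignedMeasure = μ ∧ jn μ.toSignedMeasure = 0 := by
  let j : JordanDecomposition EReal :=
    { posPart := μ, negPart := 0, mutuallySingular := Measure.MutuallySingular.zero_right }
  have h : μ.toSignedMeasure = j.toSignedMeasure := by
    simp [j, JordanDecomposition.toSignedMeasure]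
  have h2 := SignedMeasure.toJordanDecomposition_eq h
  unfold jp jn
  rw [h2]
  exact ⟨rfl, rfl⟩

lemma sInt_pos (μ : Measure EReal) [IsFiniteMeasure μ] (f : EReal → ℝ) :
    sInt f μ.toSignedMeasure = ∫ α, f α ∂μ := by
  unfold sInt
  rw [(jordan_pos μ).1, (jordan_pos μ).2]
  simp

lemma sConv_pos (μ ν : Measure EReal) [IsFiniteMeasure μ] [IsFiniteMeasure ν] :
    sConv μ.toSignedMeasure ν.toSignedMeasure = (mConv μ ν).toSignedMeasure := by
  have h1 := (jordan_pos μ).1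
  have h2 := (jordan_pos μ).2
  have h3 := (jordan_pos ν).1
  have h4 := (jordan_pos ν).2
  ext E hE
  simp [sConv, h1, h2, h3, h4, mConv]

lemma sCheck_pos (μ ν : Measure EReal) [IsFiniteMeasure μ] [IsFiniteMeasure ν] :
    sCheck μ.toSignedMeasure ν.toSignedMeasure = (mCheck μ ν).toSignedMeasure := by
  have h1 := (jordan_pos μ).1
  have h2 := (jordan_pos μ).2
  have h3 := (jordan_pos ν).1
  have h4 := (jordan_pos ν).2
  ext E hE
  simp [sCheck, h1, h2, h3, h4, mCheck]

/-- A signed measure which is a finite symmetric nonnegative measure. -/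
def Good (x : SM) : Prop :=
  ∃ (μ : Measure EReal) (_ : IsFiniteMeasure μ), x = μ.toSignedMeasure ∧ Sy μ

/-- Good, and not concentrated at `+∞`. -/
def GoodNT (x : SM) : Prop :=
  ∃ (μ : Measure EReal) (_ : IsFiniteMeasure μ), x = μ.toSignedMeasure ∧ Sy μ ∧ NT μ

lemma GoodNT.good {x : SM} (h : GoodNT x) : Good x := by
  obtain ⟨μ, hμ, e, h1, -⟩ := h
  exact ⟨μ, hμ, e, h1⟩

lemma Sy_dirac_top : Sy (Measure.dirac ⊤) := by
  intro φ hφ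
  simp [qm, tanhHalf_top]

lemma Sy_dirac_zero : Sy (Measure.dirac 0) := by
  intro φ hφ
  simp

lemma good_dTop : Good dTop := ⟨_, inferInstance, rfl, Sy_dirac_top⟩

lemma goodNT_d0 : GoodNT d0 := by
  refine ⟨_, inferInstance, rfl, Sy_dirac_zero, ?_⟩
  simp [NT]

lemma GoodNT.check {x y : SM} (hx : Good x) (hxz : x ≠ 0) (hy : GoodNT y) :
    GoodNT (sCheck x y) := by
  obtain ⟨μ, hμ, rfl, h1⟩ := hx
  obtain ⟨ν, hν, rfl, h2, h3⟩ := hy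
  refine ⟨mCheck μ ν, inferInstance, sCheck_pos μ ν, h1.check h2, ?_⟩
  have hμ0 : μ Set.univ ≠ 0 := by
    intro h
    rw [Measure.measure_univ_eq_zero] at h
    subst h
    exact hxz (by simp)
  intro h0
  unfold mCheck at h0
  rw [Measure.map_apply measurable_checkMap (measurableSet_singleton _).compl] at h0
  have hsub : (Set.univ : Set EReal) ×ˢ ({⊤}ᶜ \ {⊥} : Set EReal) ⊆
      (fun p : EReal × EReal => atanhTwo (tanhHalf p.1 * tanhHalf p.2)) ⁻¹' {⊤}ᶜ := by
    rintro ⟨a, b⟩ ⟨-, hb1, hb2⟩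
    simp only [Set.mem_preimage, Set.mem_compl_iff, Set.mem_singleton_iff] at *
    intro h
    have ha := tanhHalf_mem a
    have hab := mul_mem_bd ha (tanhHalf_mem b)
    have e := tanhHalf_atanhTwo _ hab.1 hab.2
    rw [h, tanhHalf_top] at e
    induction b with
    | bot => simp at hb2
    | top => simp at hb1
    | coe b =>
      have hb := tanhHalf_coe_lt b
      have h5 : |tanhHalf a * tanhHalf b| < 1 := by
        rw [abs_mul]
        have := abs_lt.2 hb
        calc _ ≤ 1 * |tanhHalf b| := by gcongr; exact tanhHalf_abs_le a
          _ < 1 := by linarith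
      rw [← e] at h5
      simp at h5
  have h4 := measure_mono_null hsub h0
  rw [Measure.prod_prod, mul_eq_zero] at h4
  rcases h4 with h4 | h4
  · exact hμ0 h4
  · rw [measure_sdiff_null h2.bot] at h4
    exact h3 h4

lemma GoodNT.ne_zero {x : SM} (h : GoodNT x) : x ≠ 0 := by
  obtain ⟨μ, hμ, rfl, -, h3⟩ := h
  intro h
  rw [← Measure.toSignedMeasure_zero, Measure.toSignedMeasure_eq_toSignedMeasure_iff] at h
  subst h
  simp [NT] at h3

lemma dTop_ne_zero : dTop ≠ 0 := by
  intro h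
  unfold dTop at h
  rw [← Measure.toSignedMeasure_zero, Measure.toSignedMeasure_eq_toSignedMeasure_iff] at h
  have := congrArg (fun m : Measure EReal => m Set.univ) h
  simp at this

lemma GoodNT.conv {x y : SM} (hx : GoodNT x) (hy : GoodNT y) : GoodNT (sConv x y) := by
  obtain ⟨μ, hμ, rfl, h1, h1'⟩ := hx
  obtain ⟨ν, hν, rfl, h2, h3⟩ := hy
  refine ⟨mConv μ ν, inferInstance, sConv_pos μ ν, h1.conv h2, ?_⟩
  intro h0
  unfold mConv at h0
  rw [Measure.map_apply (by fun_prop) (measurableSet_singleton _).compl] at h0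
  have hsub : ({⊤}ᶜ : Set EReal) ×ˢ ({⊤}ᶜ : Set EReal) ⊆
      (fun p : EReal × EReal => p.1 + p.2) ⁻¹' {⊤}ᶜ := by
    rintro ⟨a, b⟩ ⟨ha, hb⟩
    exact EReal.add_ne_top ha hb
  have h4 := measure_mono_null hsub h0
  rw [Measure.prod_prod, mul_eq_zero] at h4
  exact h4.elim h1' h3

lemma Good.smul {x : SM} (h : Good x) {r : ℝ} (hr : 0 ≤ r) : Good (r • x) := by
  obtain ⟨μ, hμ, rfl, h1⟩ := h
  lift r to NNReal using hr
  refine ⟨r • μ, inferInstance, (Measure.toSignedMeasure_smul μ r).symm, ?_⟩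
  intro φ hφ
  rw [lintegral_smul_measure, lintegral_smul_measure, h1 φ hφ]

lemma GoodNT.smul {x : SM} (h : GoodNT x) {r : ℝ} (hr : 0 < r) : GoodNT (r • x) := by
  obtain ⟨μ, hμ, rfl, h1, h2⟩ := h
  lift r to NNReal using hr.le
  refine ⟨r • μ, inferInstance, (Measure.toSignedMeasure_smul μ r).symm, ?_, ?_⟩
  · intro φ hφ
    rw [lintegral_smul_measure, lintegral_smul_measure, h1 φ hφ]
  · unfold NT at *
    have : r ≠ 0 := by rintro rfl; simp at hr
    rw [Measure.smul_apply]
    simp [this, h2]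

lemma Good.zero : Good 0 :=
  ⟨0, inferInstance, by simp, fun φ _ => by simp⟩

lemma Good.add {x y : SM} (hx : Good x) (hy : Good y) : Good (x + y) := by
  obtain ⟨μ, hμ, rfl, h1⟩ := hx
  obtain ⟨ν, hν, rfl, h2⟩ := hy
  refine ⟨μ + ν, inferInstance, (Measure.toSignedMeasure_add μ ν).symm, ?_⟩
  intro φ hφ
  rw [lintegral_add_measure, lintegral_add_measure, h1 φ hφ, h2 φ hφ]

lemma GoodNT.add {x y : SM} (hx : GoodNT x) (hy : Good y) : GoodNT (x + y) := by
  obtain ⟨μ, hμ, rfl, h1, h3⟩ := hx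
  obtain ⟨ν, hν, rfl, h2⟩ := hy
  refine ⟨μ + ν, inferInstance, (Measure.toSignedMeasure_add μ ν).symm, ?_, ?_⟩
  · intro φ hφ
    rw [lintegral_add_measure, lintegral_add_measure, h1 φ hφ, h2 φ hφ]
  · unfold NT at *
    simp [h3]

lemma GoodNT.sum (p : Polynomial ℝ) (f : ℕ → SM) (hp : ∀ n, 0 ≤ p.coeff n)
    (hf : ∀ n, 0 < p.coeff n → GoodNT (f n)) (h1 : p.eval 1 = 1) :
    GoodNT (∑ n ∈ Finset.range (p.natDegree + 1), p.coeff n • f n) := by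
  have hgood : ∀ n, Good (p.coeff n • f n) := by
    intro n
    rcases (hp n).eq_or_lt with h | h
    · rw [← h, zero_smul]; exact Good.zero
    · exact ((hf n h).smul h).good
  obtain ⟨m, hm, hmp⟩ : ∃ m ∈ Finset.range (p.natDegree + 1), 0 < p.coeff m := by
    by_contra! hcon
    rw [Polynomial.eval_eq_sum_range] at h1
    have : ∑ i ∈ Finset.range (p.natDegree + 1), p.coeff i * 1 ^ i ≤ 0 :=
      Finset.sum_nonpos fun i hi => by simpa using hcon i hi
    linarith
  rw [← Finset.add_sum_erase _ _ hm]
  refine ((hf m hmp).smul hmp).add ?_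
  exact Finset.sum_induction _ Good (fun a b => Good.add) Good.zero (fun n _ => hgood n)

lemma goodNT_checkPow {x : SM} (hx : GoodNT x) (n : ℕ) : GoodNT (checkPow x (n + 1)) := by
  induction n with
  | zero => exact GoodNT.check good_dTop dTop_ne_zero hx
  | succ n ih => exact GoodNT.check ih.good ih.ne_zero hx

lemma goodNT_convPow {x : SM} (hx : GoodNT x) (n : ℕ) : GoodNT (convPow x n) := by
  induction n with
  | zero => exact goodNT_d0
  | succ n ih => exact GoodNT.conv ih hx

lemma MemX.repr {x : SM} (h : MemX x) :
    ∃ (μ : Measure EReal) (_ : IsProbabilityMeasure μ), x = μ.toSignedMeasure ∧ Sy μ := by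
  obtain ⟨⟨μ, hμ, rfl⟩, h1, -⟩ := h
  refine ⟨μ, hμ, rfl, Sy_of_isSymm ?_⟩
  rwa [(jordan_pos μ).1] at h1

lemma MemX.goodNT {x : SM} (h : MemX x) (hne : x ≠ dTop) : GoodNT x := by
  obtain ⟨μ, hμ, rfl, hs⟩ := h.repr
  refine ⟨μ, inferInstance, rfl, hs, ?_⟩
  intro h0
  apply hne
  unfold dTop
  rw [Measure.toSignedMeasure_eq_toSignedMeasure_iff]
  have h1 : μ {⊤} = 1 := by
    rwa [prob_compl_eq_zero_iff (measurableSet_singleton _)] at h0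
  ext E hE
  rw [Measure.dirac_apply' _ hE]
  by_cases ht : (⊤ : EReal) ∈ E
  · rw [Set.indicator_of_mem ht]
    have h2 : μ {⊤} ≤ μ E := measure_mono (Set.singleton_subset_iff.2 ht)
    rw [h1] at h2
    exact le_antisymm prob_le_one h2
  · rw [Set.indicator_of_notMem ht]
    refine measure_mono_null ?_ h0
    intro a ha h2
    exact ht (h2 ▸ ha)

lemma L_coeff_nonneg (lam L : Polynomial ℝ) (hlamnn : ∀ n, 0 ≤ lam.coeff n)
    (hL0 : L.eval 0 = 0) (hL1 : L.eval 1 = 1)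
    (hLd : derivative L = Polynomial.C ((derivative L).eval 1) * lam) :
    ∀ n, 0 ≤ L.coeff n := by
  set d := (derivative L).eval 1 with hd
  have hc : ∀ n, L.coeff (n + 1) * ((n : ℝ) + 1) = d * lam.coeff n := by
    intro n
    have := congrArg (fun p => Polynomial.coeff p n) hLd
    simpa [Polynomial.coeff_derivative] using this
  have h0 : L.coeff 0 = 0 := by rwa [Polynomial.coeff_zero_eq_eval_zero]
  rcases le_or_gt 0 d with h | h
  · intro n
    cases n with
    | zero => exact h0.ge
    | succ n =>
      have h1 := hc n
      have h2 : 0 ≤ d * lam.coeff n := mul_nonneg h (hlamnn n)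
      rw [← h1] at h2
      exact nonneg_of_mul_nonneg_left h2 (by positivity)
  · exfalso
    have hneg : ∀ n, L.coeff n ≤ 0 := by
      intro n
      cases n with
      | zero => exact h0.le
      | succ n =>
        have h1 := hc n
        have h2 : d * lam.coeff n ≤ 0 := mul_nonpos_of_nonpos_of_nonneg h.le (hlamnn n)
        rw [← h1] at h2
        by_contra! h3
        have : 0 < L.coeff (n + 1) * ((n : ℝ) + 1) := by positivity
        linarith
    rw [Polynomial.eval_eq_sum_range] at hL1
    have : ∑ i ∈ Finset.range (L.natDegree + 1), L.coeff i * 1 ^ i ≤ 0 :=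
      Finset.sum_nonpos fun i hi => by simpa using hneg i
    linarith

/-- `tanh(α/2)^2` as a point of the unit interval. -/
def sq (α : EReal) : Set.Icc (0 : ℝ) 1 :=
  ⟨tanhHalf α ^ 2, sq_nonneg _, (sq_le_one_iff_abs_le_one _).2 (tanhHalf_abs_le α)⟩

lemma measurable_sq : Measurable sq := (measurable_tanhHalf.pow_const 2).subtype_mk

lemma map_eq_of_moments (μ ν : Measure EReal) [IsProbabilityMeasure μ] [IsProbabilityMeasure ν]
    (h : ∀ k, Mk μ k = Mk ν k) : μ.map sq = ν.map sq := by
  have hp : ∀ p : Polynomial ℝ, ∫ u, p.eval (u : ℝ) ∂(μ.map sq) = ∫ u, p.eval (u : ℝ) ∂(ν.map sq) := by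
    intro p
    have hm : Measurable fun u : Set.Icc (0 : ℝ) 1 => p.eval (u : ℝ) :=
      (p.continuous.comp continuous_subtype_val).measurable
    rw [integral_map measurable_sq.aemeasurable hm.aestronglyMeasurable,
      integral_map measurable_sq.aemeasurable hm.aestronglyMeasurable]
    simp only [sq, Polynomial.eval_eq_sum_range, ← pow_mul]
    rw [integral_finsetSum _ (fun i _ => (integrable_pow μ _).const_mul _),
      integral_finsetSum _ (fun i _ => (integrable_pow ν _).const_mul _)]
    refine Finset.sum_congr rfl fun i _ => ?_
    rw [integral_const_mul, integral_const_mul]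
    cases i with
    | zero => simp
    | succ i => congr 1; exact h i
  have : IsProbabilityMeasure (μ.map sq) := Measure.isProbabilityMeasure_map measurable_sq.aemeasurable
  have : IsProbabilityMeasure (ν.map sq) := Measure.isProbabilityMeasure_map measurable_sq.aemeasurable
  refine ext_of_forall_integral_eq_of_IsFiniteMeasure fun f => ?_
  refine eq_of_forall_dist_le fun ε hε => ?_
  obtain ⟨p, hpf⟩ := exists_polynomial_near_continuousMap 0 1 f.toContinuousMap (ε / 2) (by positivity)
  have hb : ∀ u : Set.Icc (0 : ℝ) 1, |p.eval (u : ℝ) - f u| ≤ ε / 2 := by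
    intro u
    have := (ContinuousMap.norm_coe_le_norm (p.toContinuousMapOn (Set.Icc 0 1) - f.toContinuousMap) u)
    simp only [ContinuousMap.coe_sub, Pi.sub_apply, Real.norm_eq_abs] at this
    exact this.trans hpf.le
  have key : ∀ m : Measure (Set.Icc (0 : ℝ) 1), IsProbabilityMeasure m →
      |∫ u, f u ∂m - ∫ u, p.eval (u : ℝ) ∂m| ≤ ε / 2 := by
    intro m hm
    have ip : Integrable (fun u : Set.Icc (0 : ℝ) 1 => p.eval (u : ℝ)) m := by
      have : Integrable (fun u => (BoundedContinuousFunction.mkOfCompact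
        (p.toContinuousMapOn (Set.Icc 0 1))) u) m := BoundedContinuousFunction.integrable _ _
      exact this
    rw [← integral_sub (f.integrable m) ip]
    have := norm_integral_le_of_norm_le_const (μ := m) (f := fun u : Set.Icc (0 : ℝ) 1 => f u - p.eval (u : ℝ))
      (C := ε / 2) (Eventually.of_forall fun u => by
        rw [Real.norm_eq_abs, abs_sub_comm]; exact hb u)
    simpa using this
  have k1 := key (μ.map sq) inferInstance
  have k2 := key (ν.map sq) inferInstance
  rw [hp p] at k1
  rw [Real.dist_eq]
  have := abs_sub_le (∫ u, f u ∂(μ.map sq)) (∫ u, p.eval (u : ℝ) ∂(ν.map sq)) (∫ u, f u ∂(ν.map sq))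
  rw [abs_sub_comm (∫ u, p.eval (u : ℝ) ∂(ν.map sq))] at this
  linarith

lemma If_map (μ : Measure EReal) [IsFiniteMeasure μ] (f : ℝ → ℝ)
    (hf : AntitoneOn f (Set.Icc (0 : ℝ) 1)) :
    If f μ.toSignedMeasure = ∫ u : Set.Icc (0 : ℝ) 1, f (Real.sqrt u) ∂(μ.map sq) := by
  have hm : Measurable fun u : Set.Icc (0 : ℝ) 1 => f (Real.sqrt u) := by
    apply Antitone.measurable
    intro u v huv
    have hmem : ∀ w : Set.Icc (0 : ℝ) 1, Real.sqrt w ∈ Set.Icc (0 : ℝ) 1 := fun w =>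
      ⟨Real.sqrt_nonneg _, Real.sqrt_le_one.2 w.2.2⟩
    exact hf (hmem u) (hmem v) (Real.sqrt_le_sqrt huv)
  rw [If, sInt_pos, integral_map measurable_sq.aemeasurable hm.aestronglyMeasurable]
  simp only [sq, Real.sqrt_sq_eq_abs]

lemma Mk_le (μ ν : Measure EReal) [IsProbabilityMeasure μ] [IsProbabilityMeasure ν]
    (h : Degraded μ.toSignedMeasure ν.toSignedMeasure) (k : ℕ) : Mk μ k ≤ Mk ν k := by
  have h1 := h (fun t => 1 - t ^ (2 * (k + 1))) ?_ ?_
  · simp only [If, sInt_pos] at h1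
    have e : ∀ m : Measure EReal, IsProbabilityMeasure m →
        ∫ α, (1 - |tanhHalf α| ^ (2 * (k + 1))) ∂m = 1 - Mk m k := by
      intro m hm
      have e1 : ∀ α, |tanhHalf α| ^ (2 * (k + 1)) = tanhHalf α ^ (2 * (k + 1)) := fun α =>
        Even.pow_abs ⟨k + 1, by ring⟩ _
      simp only [e1]
      rw [integral_sub (integrable_const _) (integrable_pow m _)]
      simp [Mk]
    rw [e μ inferInstance, e ν inferInstance] at h1
    linarith
  · have := (convexOn_pow (𝕜 := ℝ) (2 * (k + 1))).subset Set.Icc_subset_Ici_self (convex_Icc 0 1)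
    exact (concaveOn_const 1 (convex_Icc 0 1)).sub this
  · intro a ha b hb hab
    have := pow_le_pow_left₀ ha.1 hab (2 * (k + 1))
    simp only
    linarith

/-- Strict monotonicity of the potential in the channel: if
`c1 ≻ c2` and `x ∈ X` with `x ≠ Δ_∞`, then `U(x; c1) < U(x; c2)`. -/
theorem potential_strictly_decreasing_in_channel
    (lam rho L R : Polynomial ℝ)
    (hlam0 : lam.coeff 0 = 0) (hrho0 : rho.coeff 0 = 0)
    (hlamnn : ∀ n, 0 ≤ lam.coeff n) (hrhonn : ∀ n, 0 ≤ rho.coeff n)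
    (hlam1 : lam.eval 1 = 1) (hrho1 : rho.eval 1 = 1)
    (hL0 : L.eval 0 = 0) (hL1 : L.eval 1 = 1)
    (hR0 : R.eval 0 = 0) (hR1 : R.eval 1 = 1)
    (hLd : derivative L = Polynomial.C ((derivative L).eval 1) * lam)
    (hRd : derivative R = Polynomial.C ((derivative R).eval 1) * rho)
    (c1 c2 x : SM) (hc1 : MemX c1) (hc2 : MemX c2) (hx : MemX x)
    (hdeg : StrictlyDegraded c1 c2) (hne : x ≠ dTop) :
    potU rho L R x c1 < potU rho L R x c2 := by
  have hz : GoodNT (polyCheck rho x) := by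
    refine GoodNT.sum rho _ hrhonn (fun n hn => ?_) hrho1
    cases n with
    | zero => rw [hrho0] at hn; exact absurd hn (lt_irrefl _)
    | succ n => exact goodNT_checkPow (hx.goodNT hne) n
  have hy : GoodNT (polyConv L (polyCheck rho x)) :=
    GoodNT.sum L _ (L_coeff_nonneg lam L hlamnn hL0 hL1 hLd) (fun n _ => goodNT_convPow hz n) hL1
  obtain ⟨ν, hν, ey, sν, nν⟩ := hy
  obtain ⟨μ1, hμ1, rfl, s1⟩ := hc1.repr
  obtain ⟨μ2, hμ2, rfl, s2⟩ := hc2.repr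
  obtain ⟨hd, f, -, hf2, hf3⟩ := hdeg
  have hle := Mk_le μ1 μ2 hd
  obtain ⟨k, hk⟩ : ∃ k, Mk μ1 k < Mk μ2 k := by
    by_contra! hcon
    have := map_eq_of_moments μ1 μ2 fun k => le_antisymm (hle k) (hcon k)
    rw [If_map μ1 f hf2, If_map μ2 f hf2, this] at hf3
    exact lt_irrefl _ hf3
  have hlt := hasSum_lt (i := k)
    (fun j => mul_le_mul_of_nonneg_right (mul_le_mul_of_nonneg_left (hle j) (ak_pos j).le)
      (nν.pos sν j).le)
    (mul_lt_mul_of_pos_right (mul_lt_mul_of_pos_left hk (ak_pos k)) (nν.pos sν k))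
    (hasSum_D μ1 ν) (hasSum_D μ2 ν)
  have hlog : 0 < Real.log 2 := Real.log_pos one_lt_two
  have hH : H (sConv μ2.toSignedMeasure ν.toSignedMeasure)
      < H (sConv μ1.toSignedMeasure ν.toSignedMeasure) := by
    rw [sConv_pos, sConv_pos, H, H, sInt_pos, sInt_pos, ent_conv s1 sν, ent_conv s2 sν,
      ent_diff, ent_diff]
    have := div_lt_div_of_pos_right hlt hlog
    linarith
  unfold potU
  rw [ey]
  linarith

end SCLDPC
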